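/- Let (V,‖·‖) be a separable Banach space and let G : ℝ^p → V be a locally Lipschitz operator. Let μ be a random vector in ℝ^p and let u_μ := G(μ) be the induced V-valued random variable; assume E‖u_μ‖ < +∞. Let B := G({c ∈ ℝ^p : |c| ≤ 1}) be the image of the closed unit ball. Then there exists L₀ > 0 such that for all M ≥ 1, all L ≥ L₀, and all latent dimensions n ≥ p, the infimum over admissible encoder–decoder pairs vanishes: inf { E‖u_μ − Ψ(Ψ′(u_μ))‖ : Ψ′ ∈ ℰ_{B,M}(V,ℝⁿ), Ψ ∈ 𝒟_{M,L}(ℝⁿ,V) } = 0. -/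

import Mathlib

open MeasureTheory Filter Metric
open scoped ENNReal NNReal

/-- The local variation of an operator `G` between normed spaces at a point `w`:
`‖∂G‖(w) := limsup_{h→0, h≠0} ‖G(w+h) − G(w)‖ / ‖h‖`, a value in `[0,+∞]`. -/
noncomputable def locVar {W V : Type*} [NormedAddCommGroup W] [NormedAddCommGroup V]
    (G : W → V) (w : W) : ℝ≥0∞ :=
  Filter.limsup (fun h : W => ENNReal.ofReal (‖G (w + h) - G w‖ / ‖h‖)) (nhdsWithin 0 {0}ᶜ)

theorem locVar_le_of_eventuallyEq_lipschitz {W V : Type*} [NormedAddCommGroup W]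
    [NormedAddCommGroup V] {F H : W → V} {K : ℝ≥0} (hH : LipschitzWith K H) {w : W}
    (h : F =ᶠ[nhds w] H) : locVar F w ≤ K := by
  refine Filter.limsup_le_of_le (h := ?_)
  have h0 : Tendsto (fun x : W => w + x) (nhds 0) (nhds w) := by
    have := (continuous_const_add w).tendsto (0 : W)
    rwa [add_zero] at this
  filter_upwards [(h0.eventually h).filter_mono nhdsWithin_le_nhds, self_mem_nhdsWithin]
    with x hx hx0
  rw [hx, h.self_of_nhds, ENNReal.ofReal_le_iff_le_toReal ENNReal.coe_ne_top, ENNReal.coe_toReal,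
    div_le_iff₀ (norm_pos_iff.2 hx0)]
  simpa [dist_eq_norm] using hH.dist_le_mul (w + x) w

theorem lipschitzWith_inv_max_one_norm_smul {E : Type*} [NormedAddCommGroup E]
    [NormedSpace ℝ E] : LipschitzWith 2 (fun x : E => (max 1 ‖x‖)⁻¹ • x) := by
  refine LipschitzWith.of_dist_le_mul fun x y => ?_
  simp only [dist_eq_norm, NNReal.coe_ofNat]
  set a := max 1 ‖x‖ with ha
  set b := max 1 ‖y‖ with hb
  have ha1 : 1 ≤ a := le_max_left _ _
  have hb1 : 1 ≤ b := le_max_left _ _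
  have hyb : ‖y‖ ≤ b := le_max_right _ _
  have hba : |b - a| ≤ ‖x - y‖ := by
    calc |b - a| ≤ |‖y‖ - ‖x‖| := by
          rw [ha, hb]
          simpa using abs_max_sub_max_le_max 1 ‖y‖ 1 ‖x‖
      _ ≤ ‖y - x‖ := abs_norm_sub_norm_le y x
      _ = ‖x - y‖ := norm_sub_rev y x
  have hdec : a⁻¹ • x - b⁻¹ • y = a⁻¹ • (x - y) + (a⁻¹ * (b - a) * b⁻¹) • y := by
    have : a⁻¹ * (b - a) * b⁻¹ = a⁻¹ - b⁻¹ := by field_simp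
    rw [this]
    module
  have hainv : a⁻¹ ≤ 1 := inv_le_one_of_one_le₀ ha1
  have h1 : ‖a⁻¹ • (x - y)‖ ≤ ‖x - y‖ := by
    rw [norm_smul, Real.norm_of_nonneg (by positivity)]
    exact mul_le_of_le_one_left (norm_nonneg _) hainv
  have h2 : ‖(a⁻¹ * (b - a) * b⁻¹) • y‖ ≤ ‖x - y‖ := by
    rw [norm_smul, norm_mul, norm_mul, Real.norm_of_nonneg (by positivity : 0 ≤ a⁻¹),
      Real.norm_of_nonneg (by positivity : 0 ≤ b⁻¹), Real.norm_eq_abs, mul_assoc]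
    have h3 : b⁻¹ * ‖y‖ ≤ 1 := by
      rw [inv_mul_le_iff₀ (by positivity), mul_one]
      exact hyb
    calc a⁻¹ * |b - a| * (b⁻¹ * ‖y‖) ≤ 1 * ‖x - y‖ * 1 := by gcongr
      _ = ‖x - y‖ := by ring
  rw [hdec]
  linarith [norm_add_le (a⁻¹ • (x - y)) ((a⁻¹ * (b - a) * b⁻¹) • y)]

theorem norm_inv_max_one_norm_smul_le {E : Type*} [NormedAddCommGroup E] [NormedSpace ℝ E]
    (x : E) : ‖(max 1 ‖x‖)⁻¹ • x‖ ≤ 1 := by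
  rw [norm_smul, Real.norm_of_nonneg (by positivity), inv_mul_le_iff₀ (by positivity), mul_one]
  exact le_max_right _ _

theorem inv_max_one_norm_smul_of_norm_le {E : Type*} [NormedAddCommGroup E] [NormedSpace ℝ E]
    {x : E} (hx : ‖x‖ ≤ 1) : (max 1 ‖x‖)⁻¹ • x = x := by
  rw [max_eq_left hx, inv_one, one_smul]

theorem EuclideanSpace.exists_nonexpansive_leftInverse {p n : ℕ} (h : p ≤ n) :
    ∃ (i : EuclideanSpace ℝ (Fin p) → EuclideanSpace ℝ (Fin n))
      (q : EuclideanSpace ℝ (Fin n) → EuclideanSpace ℝ (Fin p)),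
      Function.LeftInverse q i ∧ (∀ x, ‖i x‖ = ‖x‖) ∧ LipschitzWith 1 q := by
  obtain ⟨k, rfl⟩ := Nat.exists_eq_add_of_le h
  refine ⟨fun x => WithLp.toLp 2 (Fin.append x.ofLp 0),
    fun y => WithLp.toLp 2 fun j => y (Fin.castAdd k j), fun x => ?_, fun x => ?_, ?_⟩
  · ext j
    simp
  · simp [EuclideanSpace.norm_eq, Fin.sum_univ_add]
  · refine LipschitzWith.of_dist_le_mul fun x y => ?_
    simp only [EuclideanSpace.dist_eq, Fin.sum_univ_add, NNReal.coe_one, one_mul]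
    exact Real.sqrt_le_sqrt (le_add_of_nonneg_right (by positivity))

theorem EuclideanSpace.norm_le_sqrt_of_forall_abs_le {n : ℕ} {M : ℝ}
    {c : EuclideanSpace ℝ (Fin n)} (hc : ∀ i, |c i| ≤ M) : ‖c‖ ≤ √(n * M ^ 2) := by
  rw [EuclideanSpace.norm_eq]
  refine Real.sqrt_le_sqrt ?_
  calc ∑ i, ‖c i‖ ^ 2 ≤ ∑ _i : Fin n, M ^ 2 :=
        Finset.sum_le_sum fun i _ => pow_le_pow_left₀ (norm_nonneg _) (hc i) 2
    _ = n * M ^ 2 := by simp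

theorem MeasureTheory.SimpleFunc.exists_lintegral_enorm_sub_le {V : Type*}
    [NormedAddCommGroup V] [SecondCountableTopology V] [MeasurableSpace V] [BorelSpace V]
    (ν : Measure V) [IsFiniteMeasure ν] (hν : ∫⁻ v, ‖v‖ₑ ∂ν < ⊤) {s : Set V}
    (hne : s.Nonempty) (hs : ∀ᵐ v ∂ν, v ∈ s) {ε : ℝ≥0∞} (hε : 0 < ε) :
    ∃ f : SimpleFunc V V, (∀ v, f v ∈ s) ∧ ∫⁻ v, ‖v - f v‖ₑ ∂ν ≤ ε := by
  obtain ⟨y, hy⟩ := hne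
  have hfin : Integrable (fun v : V => v - y) ν :=
    Integrable.sub ⟨measurable_id.aestronglyMeasurable, hν⟩ (integrable_const y)
  have ht := SimpleFunc.tendsto_approxOn_L1_enorm (f := fun v : V => v) measurable_id hy
    (hs.mono fun v hv => subset_closure hv) hfin.2
  obtain ⟨n, hn⟩ := (ht.eventually (ge_mem_nhds hε)).exists
  refine ⟨_, SimpleFunc.approxOn_mem measurable_id hy n, ?_⟩
  simp only [enorm_sub_rev] at hn ⊢
  exact hn

/-- A simple encoder into `ℝⁿ` together with a decoder that agrees with the `K`-Lipschitz map `H`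
on a ball of radius `N`; the values off `B` are stored outside that ball. -/
theorem exists_simple_encoder_decoder {V : Type*} [NormedAddCommGroup V]
    [SecondCountableTopology V] [MeasurableSpace V] [BorelSpace V] (ν : Measure V)
    [IsFiniteMeasure ν] (hν : ∫⁻ v, ‖v‖ₑ ∂ν < ⊤) {n : ℕ} (i₀ : Fin n)
    {H : EuclideanSpace ℝ (Fin n) → V} (hH : Continuous H) {B : Set V} (hB : MeasurableSet B)
    (hne : B.Nonempty) (hHB : ∀ v ∈ B, ∃ c, ‖c‖ ≤ 1 ∧ H c = v) {N : ℕ} (hN : 1 ≤ N) {ε : ℝ≥0∞}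
    (hε : 0 < ε) :
    ∃ (e : SimpleFunc V (EuclideanSpace ℝ (Fin n))) (D : EuclideanSpace ℝ (Fin n) → V),
      Measurable D ∧ (∀ c, ‖c‖ ≤ N → D c = H c) ∧ (∀ v ∈ B, ‖e v‖ ≤ 1) ∧
        ∫⁻ v, ‖v - D (e v)‖ₑ ∂ν ≤ ε := by
  classical
  have hε2 : 0 < ε / 2 := ENNReal.half_pos hε.ne'
  have hνr (s : Set V) : ∫⁻ v, ‖v‖ₑ ∂(ν.restrict s) < ⊤ :=
    (setLIntegral_le_lintegral s _).trans_lt hν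
  obtain ⟨f, hfB, hf⟩ := SimpleFunc.exists_lintegral_enorm_sub_le (ν.restrict B) (hνr B) hne
    (ae_restrict_mem hB) hε2
  obtain ⟨g, -, hg⟩ := SimpleFunc.exists_lintegral_enorm_sub_le (ν.restrict Bᶜ) (hνr Bᶜ)
    Set.univ_nonempty (by simp) hε2
  choose! r hr1 hrH using hHB
  obtain ⟨k, hk⟩ := Set.countable_iff_exists_injOn.1 g.finite_range.countable
  let code : V → EuclideanSpace ℝ (Fin n) := fun v =>
    EuclideanSpace.single i₀ ((N + 1 + k v : ℕ) : ℝ)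
  let D : EuclideanSpace ℝ (Fin n) → V := fun c =>
    if ‖c‖ ≤ N then H c else Function.invFunOn k (Set.range g) (⌊c i₀⌋₊ - (N + 1))
  have hDcode (v : V) : D (code (g v)) = g v := by
    have hnorm : ¬ ‖code (g v)‖ ≤ N := by
      simp only [code, PiLp.norm_single, Real.norm_natCast, Nat.cast_le]
      omega
    have hfl : ⌊code (g v) i₀⌋₊ - (N + 1) = k (g v) := by
      simp only [code, PiLp.single_apply, if_true, Nat.floor_natCast]
      omega
    simp only [D, if_neg hnorm, hfl]
    exact hk.leftInvOn_invFunOn (Set.mem_range_self v)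
  have hDH (c : EuclideanSpace ℝ (Fin n)) (hc : ‖c‖ ≤ N) : D c = H c := if_pos hc
  refine ⟨SimpleFunc.piecewise B hB (f.map r) (g.map code), D, ?_, hDH, fun v hv => ?_, ?_⟩
  · have hcoord : Measurable fun c : EuclideanSpace ℝ (Fin n) => c i₀ :=
      Continuous.measurable (by fun_prop)
    exact Measurable.ite (measurableSet_le measurable_norm measurable_const) hH.measurable
      ((measurable_from_nat (f := fun m => Function.invFunOn k (Set.range g) (m - (N + 1)))).comp
        (Nat.measurable_floor.comp hcoord))
  · simpa [hv] using hr1 _ (hfB v)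
  · rw [← lintegral_add_compl _ hB, ← ENNReal.add_halves ε]
    refine add_le_add (le_of_eq_of_le (setLIntegral_congr_fun hB fun v hv => ?_) hf)
      (le_of_eq_of_le (setLIntegral_congr_fun hB.compl fun v hv => ?_) hg)
    · have h1 : ‖r (f v)‖ ≤ N := (hr1 _ (hfB v)).trans (by exact_mod_cast hN)
      simp [hv, hDH _ h1, hrH _ (hfB v)]
    · have hv' : v ∉ B := hv
      simp [hv', hDcode]

/-- **finite-rank case.** Let `V` be a separable Banach space, `G : ℝ^p → V`
locally Lipschitz, `μ` a random vector in `ℝ^p`, `u_μ := G(μ)` with `E‖u_μ‖ < +∞`, and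
`B := G({|c| ≤ 1})`. Then there exists `L₀ > 0` such that for all `M ≥ 1`, all `L ≥ L₀` and
all latent dimensions `n ≥ p`, the infimum of the reconstruction error
`E‖u_μ − Ψ(Ψ′(u_μ))‖` over admissible encoders `Ψ′ ∈ ℰ_{B,M}(V,ℝⁿ)` (Borel measurable,
`E|Ψ′(u_μ)| < ∞`, `sup_{v∈B}|Ψ′(v)| ≤ M`) and admissible decoders `Ψ ∈ 𝒟_{M,L}(ℝⁿ,V)`
(Borel measurable, `sup_{c∈[−M,M]ⁿ} ‖∂Ψ‖(c) ≤ L`) vanishes. -/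
theorem stmt_13 {V : Type*} [NormedAddCommGroup V] [NormedSpace ℝ V] [CompleteSpace V]
    [TopologicalSpace.SeparableSpace V] [MeasurableSpace V] [BorelSpace V]
    (p : ℕ) (G : EuclideanSpace ℝ (Fin p) → V) (hG : LocallyLipschitz G)
    {Ω' : Type*} [MeasurableSpace Ω'] (P : Measure Ω') [IsProbabilityMeasure P]
    (μ : Ω' → EuclideanSpace ℝ (Fin p)) (hμ : Measurable μ)
    (hInt : ∫⁻ a, (‖G (μ a)‖₊ : ℝ≥0∞) ∂P < ⊤) :
    ∃ L₀ > (0 : ℝ), ∀ M : ℝ, 1 ≤ M → ∀ L : ℝ, L₀ ≤ L → ∀ n : ℕ, p ≤ n →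
      sInf {e : ℝ≥0∞ |
        ∃ Ψ' : V → EuclideanSpace ℝ (Fin n), ∃ Ψ : EuclideanSpace ℝ (Fin n) → V,
          Measurable Ψ' ∧
          (∫⁻ a, (‖Ψ' (G (μ a))‖₊ : ℝ≥0∞) ∂P < ⊤) ∧
          (∀ x ∈ G '' closedBall (0 : EuclideanSpace ℝ (Fin p)) 1, ‖Ψ' x‖ ≤ M) ∧
          Measurable Ψ ∧
          (∀ c : EuclideanSpace ℝ (Fin n), (∀ i, |c i| ≤ M) → locVar Ψ c ≤ ENNReal.ofReal L) ∧
          e = ∫⁻ a, (‖G (μ a) - Ψ (Ψ' (G (μ a)))‖₊ : ℝ≥0∞) ∂P} = 0 := by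
  have : SecondCountableTopology V := UniformSpace.secondCountable_of_separable V
  have hu : Measurable fun a => G (μ a) := hG.continuous.measurable.comp hμ
  rcases Nat.eq_zero_or_pos p with rfl | hp
  · refine ⟨1, one_pos, fun M hM L hL n _ => le_antisymm (sInf_le ?_) bot_le⟩
    refine ⟨fun _ => 0, fun _ => G 0, measurable_const, by simp,
      fun x _ => by simpa using by linarith,
      measurable_const, fun c _ => ?_, ?_⟩
    · exact (locVar_le_of_eventuallyEq_lipschitz (LipschitzWith.const (G 0))
        Filter.EventuallyEq.rfl).trans (by simp)
    · simp [Subsingleton.elim _ (0 : EuclideanSpace ℝ (Fin 0))]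
  obtain ⟨K, hK⟩ := (hG.locallyLipschitzOn (s := closedBall 0 1)).exists_lipschitzOnWith_of_compact
    (isCompact_closedBall 0 1)
  refine ⟨K * 2 + 1, by positivity, fun M hM L hL n hn => le_antisymm ?_ bot_le⟩
  refine le_of_forall_gt_imp_ge_of_dense fun ε hε => ?_
  obtain ⟨i, q, hqi, hi, hq⟩ := EuclideanSpace.exists_nonexpansive_leftInverse hn
  let H : EuclideanSpace ℝ (Fin n) → V := fun c => G ((max 1 ‖q c‖)⁻¹ • q c)
  have hH : LipschitzWith (K * 2) H := by
    have h := hK.comp ((lipschitzWith_inv_max_one_norm_smul.comp hq).lipschitzOnWith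
      (s := Set.univ)) fun c _ => by
        simpa using norm_inv_max_one_norm_smul_le (q c)
    rw [mul_one] at h
    exact lipschitzOnWith_univ.1 h
  obtain ⟨N, hN⟩ := exists_nat_gt (max 1 √(n * M ^ 2))
  have hN1 : 1 ≤ N := by exact_mod_cast ((le_max_left _ _).trans_lt hN).le
  have hprob : IsProbabilityMeasure (P.map fun a => G (μ a)) :=
    Measure.isProbabilityMeasure_map hu.aemeasurable
  obtain ⟨e, D, hD, hDH, he, herr⟩ := exists_simple_encoder_decoder (P.map fun a => G (μ a))
    (by rw [lintegral_map measurable_enorm hu]; exact hInt) ⟨0, hp.trans_le hn⟩ hH.continuous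
    (B := G '' closedBall 0 1) ((isCompact_closedBall 0 1).image hG.continuous).measurableSet
    ⟨G 0, 0, by simp, rfl⟩
    (by
      rintro _ ⟨w, hw, rfl⟩
      have hw1 : ‖w‖ ≤ 1 := by simpa using hw
      exact ⟨i w, (hi w).trans_le hw1,
        by simp only [H, hqi w, inv_max_one_norm_smul_of_norm_le hw1]⟩)
    hN1 hε
  have hmeas : Measurable fun v => ‖v - D (e v)‖ₑ :=
    (measurable_id.sub (hD.comp e.measurable)).enorm
  rw [lintegral_map hmeas hu] at herr
  refine le_trans (sInf_le ?_) herr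
  refine ⟨e, D, e.measurable, ?_, fun x hx => (he x hx).trans hM, hD, fun c hc => ?_, rfl⟩
  · have h := (SimpleFunc.integrable_of_isFiniteMeasure e (μ := P.map fun a => G (μ a))).2
    rw [HasFiniteIntegral, lintegral_map e.measurable.enorm hu] at h
    exact h
  · have hcN : ‖c‖ < N :=
      (EuclideanSpace.norm_le_sqrt_of_forall_abs_le hc).trans_lt ((le_max_right _ _).trans_lt hN)
    have heq : D =ᶠ[nhds c] H := by
      filter_upwards [continuous_norm.continuousAt.eventually_lt_const hcN] with x hx
      exact hDH x hx.le
    refine (locVar_le_of_eventuallyEq_lipschitz hH heq).trans ?_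
    rw [← ENNReal.ofReal_coe_nnreal]
    exact ENNReal.ofReal_le_ofReal (by push_cast; linarith)
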